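/- Let I ⊂ S = K[x_1,…,x_n] be a nonzero lexsegment ideal generated by monomials of degree d. Then in the standard graded case the Hilbert depth satisfies hdepth_1(I) = 1 if and only if μ(I) > ξ_{n−1}, where ξ_k = Σ_{j=1}^k C(2j−1, j). -/

import Mathlib

noncomputable section

open MvPolynomial

/-- The total degree of an exponent vector. -/
def edeg {n : ℕ} (a : Fin n →₀ ℕ) : ℕ := ∑ i, a i

/-- An exponent vector is squarefree if every exponent is at most 1. -/
def IsSqfree {n : ℕ} (a : Fin n →₀ ℕ) : Prop := ∀ i, a i ≤ 1

/-- The set of exponent vectors of monomials belonging to the ideal `I`. -/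
def expSet {K : Type} [Field K] {n : ℕ} (I : Ideal (MvPolynomial (Fin n) K)) :
    Set (Fin n →₀ ℕ) := {a | (monomial a (1 : K)) ∈ I}

/-- `I` is generated by monomials `x^a` with `a` satisfying the predicate `P`. -/
def GenBy {K : Type} [Field K] {n : ℕ} (I : Ideal (MvPolynomial (Fin n) K))
    (P : (Fin n →₀ ℕ) → Prop) : Prop :=
  ∃ G : Set (Fin n →₀ ℕ), (∀ a ∈ G, P a) ∧
    I = Ideal.span ((fun a => (monomial a (1 : K))) '' G)

/-- `I` is a monomial ideal. -/
def IsMonomialIdeal {K : Type} [Field K] {n : ℕ} (I : Ideal (MvPolynomial (Fin n) K)) : Prop :=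
  GenBy I fun _ => True

/-- `I` is a squarefree monomial ideal. -/
def IsSqfreeMonomialIdeal {K : Type} [Field K] {n : ℕ}
    (I : Ideal (MvPolynomial (Fin n) K)) : Prop := GenBy I IsSqfree

/-- `x^a >_lex x^b` in the lexicographic order with `x_1 > x_2 > ⋯ > x_n`. -/
def lexGT {n : ℕ} (a b : Fin n →₀ ℕ) : Prop :=
  ∃ i : Fin n, (∀ j : Fin n, j < i → a j = b j) ∧ b i < a i

/-- `I` is a lexsegment ideal. -/
def IsLexsegment {K : Type} [Field K] {n : ℕ} (I : Ideal (MvPolynomial (Fin n) K)) : Prop :=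
  IsMonomialIdeal I ∧ ∀ a b : Fin n →₀ ℕ, (monomial a (1 : K)) ∈ I → edeg b = edeg a →
    lexGT b a → (monomial b (1 : K)) ∈ I

/-- `I` is a squarefree lexsegment ideal. -/
def IsSqfreeLexsegment {K : Type} [Field K] {n : ℕ}
    (I : Ideal (MvPolynomial (Fin n) K)) : Prop :=
  IsSqfreeMonomialIdeal I ∧ ∀ a b : Fin n →₀ ℕ, IsSqfree a → IsSqfree b →
    (monomial a (1 : K)) ∈ I → edeg b = edeg a → lexGT b a → (monomial b (1 : K)) ∈ I

/-- The minimal number of generators of an ideal. -/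
def mu {K : Type} [Field K] {n : ℕ} (I : Ideal (MvPolynomial (Fin n) K)) : ℕ :=
  sInf {m | ∃ G : Finset (MvPolynomial (Fin n) K), G.card = m ∧ I = Ideal.span (G : Set _)}

/-- `ξ_k = ∑_{j=1}^k C(2j-1, j)`. -/
def xi (k : ℕ) : ℕ := ∑ j ∈ Finset.Icc 1 k, (2 * j - 1).choose j

/-- The Hilbert function of `I`: the `K`-dimension of the degree-`j` component of `I`. -/
def hilb {K : Type} [Field K] {n : ℕ} (I : Ideal (MvPolynomial (Fin n) K)) (j : ℕ) : ℕ :=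
  Module.finrank K ↥((Submodule.restrictScalars K I) ⊓ homogeneousSubmodule (Fin n) K j)

/-- The Hilbert function of `I` extended to all integer degrees. -/
def hilbZ {K : Type} [Field K] {n : ℕ} (I : Ideal (MvPolynomial (Fin n) K)) (j : ℤ) : ℕ :=
  if 0 ≤ j then hilb I j.toNat else 0

/-- The Hilbert function of a standard graded polynomial ring in `d` variables,
at degree `t ∈ ℤ`. -/
def polyHilb (d : ℕ) (t : ℤ) : ℕ :=
  if t < 0 then 0 else if d = 0 then (if t = 0 then 1 else 0) else (t.toNat + (d - 1)).choose (d - 1)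

/-- A (standard graded) Hilbert decomposition of `I` all of whose retracts are polynomial
rings in at least `k` variables: `I ≅ ⊕ᵢ Sᵢ(-sᵢ)` as graded `K`-vector spaces, where `Sᵢ`
is a graded algebra retract of `S`, i.e. a polynomial ring in `dd i ≥ k` variables. -/
def HilbertDecomp1 {K : Type} [Field K] {n : ℕ} (I : Ideal (MvPolynomial (Fin n) K))
    (k : ℕ) : Prop :=
  ∃ (ι : Type) (_ : Fintype ι) (dd : ι → ℕ) (s : ι → ℤ),
    (∀ i, k ≤ dd i) ∧ ∀ j : ℤ, hilbZ I j = ∑ i, polyHilb (dd i) (j - s i)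

/-- The Hilbert depth of `I` in the standard graded sense. -/
def hdepth1 {K : Type} [Field K] {n : ℕ} (I : Ideal (MvPolynomial (Fin n) K)) : ℕ∞ :=
  sSup {k : ℕ∞ | ∃ m : ℕ, HilbertDecomp1 I m ∧ k = m}

/-- The set of exponent vectors `u + ℕ^Z`, corresponding to the Stanley space `x^u K[Z]`. -/
def cone {n : ℕ} (u : Fin n →₀ ℕ) (Z : Finset (Fin n)) : Set (Fin n →₀ ℕ) :=
  {a | (∀ j, u j ≤ a j) ∧ ∀ j ∉ Z, a j = u j}

/-- A Stanley decomposition, with all Stanley spaces of dimension at least `k`, of the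
`ℤⁿ`-graded module whose monomial basis has exponent set `A`. -/
def StanleyPartN {n : ℕ} (A : Set (Fin n →₀ ℕ)) (k : ℕ) : Prop :=
  ∃ (ι : Type) (_ : Fintype ι) (u : ι → (Fin n →₀ ℕ)) (Z : ι → Finset (Fin n)),
    (∀ i, k ≤ (Z i).card) ∧ (∀ i, cone (u i) (Z i) ⊆ A) ∧
    (∀ a ∈ A, ∃! i, a ∈ cone (u i) (Z i))

/-- The multigraded Stanley depth of the `ℤⁿ`-graded module whose monomial basis has
exponent set `A`. -/
def sdepthN {n : ℕ} (A : Set (Fin n →₀ ℕ)) : ℕ∞ :=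
  sSup {k : ℕ∞ | ∃ m : ℕ, StanleyPartN A m ∧ k = m}

/-- A multigraded Hilbert decomposition of the monomial ideal `I`, with all retracts
polynomial rings in at least `k` variables: the multigraded Hilbert function of `I`
(which takes values 0 and 1) equals the sum of the multigraded Hilbert functions of
the shifted retracts `x^{u i} K[Z i]`. -/
def HilbertDecompN {K : Type} [Field K] {n : ℕ} (I : Ideal (MvPolynomial (Fin n) K))
    (k : ℕ) : Prop :=
  ∃ (ι : Type) (_ : Fintype ι) (u : ι → (Fin n →₀ ℕ)) (Z : ι → Finset (Fin n)),
    (∀ i, k ≤ (Z i).card) ∧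
    (∀ a : Fin n →₀ ℕ, (a ∈ expSet I ↔ ∃ i, a ∈ cone (u i) (Z i)) ∧
      (∀ i i', a ∈ cone (u i) (Z i) → a ∈ cone (u i') (Z i') → i = i'))

/-- The multigraded Hilbert depth of a monomial ideal `I`. -/
def hdepthN {K : Type} [Field K] {n : ℕ} (I : Ideal (MvPolynomial (Fin n) K)) : ℕ∞ :=
  sSup {k : ℕ∞ | ∃ m : ℕ, HilbertDecompN I m ∧ k = m}

/-- The graded maximal ideal `(x_1, …, x_n)`. -/
def maxIdeal (K : Type) [Field K] (n : ℕ) : Ideal (MvPolynomial (Fin n) K) :=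
  Ideal.span (Set.range X)

/-- The depth of a module `M` over `S = K[x_1,…,x_n]` with respect to the graded maximal
ideal: the supremum of lengths of `M`-regular sequences in `(x_1,…,x_n)`. -/
def mdepth (K : Type) [Field K] (n : ℕ) (M : Type)
    [AddCommGroup M] [Module (MvPolynomial (Fin n) K) M] : ℕ∞ :=
  sSup {k : ℕ∞ | ∃ rs : List (MvPolynomial (Fin n) K),
    (∀ r ∈ rs, r ∈ maxIdeal K n) ∧ RingTheory.Sequence.IsRegular M rs ∧ k = rs.length}

/-- The quotient module `I/J` for ideals `J ≤ I`. -/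
def quotMod {K : Type} [Field K] {n : ℕ} (I J : Ideal (MvPolynomial (Fin n) K)) : Type :=
  ↥I ⧸ (Submodule.comap (Submodule.subtype I) J)

instance {K : Type} [Field K] {n : ℕ} (I J : Ideal (MvPolynomial (Fin n) K)) :
    AddCommGroup (quotMod I J) := by unfold quotMod; infer_instance

instance {K : Type} [Field K] {n : ℕ} (I J : Ideal (MvPolynomial (Fin n) K)) :
    Module (MvPolynomial (Fin n) K) (quotMod I J) := by unfold quotMod; infer_instance

/-- `ρ_j(I\J)`: the number of squarefree monomials of degree `j` in `I ∖ J`. -/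
def rho {K : Type} [Field K] {n : ℕ} (I J : Ideal (MvPolynomial (Fin n) K)) (j : ℕ) : ℕ :=
  Set.ncard {a : Fin n →₀ ℕ | IsSqfree a ∧ edeg a = j ∧ a ∈ expSet I ∧ a ∉ expSet J}

/-- `ρ_j(I)`: the number of squarefree monomials of degree `j` in `I`. -/
def rhoI {K : Type} [Field K] {n : ℕ} (I : Ideal (MvPolynomial (Fin n) K)) (j : ℕ) : ℕ :=
  Set.ncard {a : Fin n →₀ ℕ | IsSqfree a ∧ edeg a = j ∧ a ∈ expSet I}

/-- `I` is a stable monomial ideal. Here `j` plays the role of `m(u)`, the largest index of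
a variable dividing `u = x^a`. -/
def IsStable {K : Type} [Field K] {n : ℕ} (I : Ideal (MvPolynomial (Fin n) K)) : Prop :=
  IsMonomialIdeal I ∧ ∀ a : Fin n →₀ ℕ, (monomial a (1 : K)) ∈ I →
    ∀ j : Fin n, a j ≠ 0 → (∀ l, j < l → a l = 0) → ∀ i, i < j →
      (monomial (a + Finsupp.single i 1 - Finsupp.single j 1) (1 : K)) ∈ I

/-- `I` is a squarefree stable monomial ideal. -/
def IsSqfreeStable {K : Type} [Field K] {n : ℕ} (I : Ideal (MvPolynomial (Fin n) K)) : Prop :=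
  IsSqfreeMonomialIdeal I ∧ ∀ a : Fin n →₀ ℕ, IsSqfree a → (monomial a (1 : K)) ∈ I →
    ∀ j : Fin n, a j ≠ 0 → (∀ l, j < l → a l = 0) → ∀ i, i < j → a i = 0 →
      (monomial (a + Finsupp.single i 1 - Finsupp.single j 1) (1 : K)) ∈ I

/-- `I` is a squarefree strongly stable monomial ideal. -/
def IsSqfreeStronglyStable {K : Type} [Field K] {n : ℕ}
    (I : Ideal (MvPolynomial (Fin n) K)) : Prop :=
  IsSqfreeMonomialIdeal I ∧ ∀ a : Fin n →₀ ℕ, IsSqfree a → (monomial a (1 : K)) ∈ I →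
    ∀ i : Fin n, a i ≠ 0 → ∀ j, j < i → a j = 0 →
      (monomial (a + Finsupp.single j 1 - Finsupp.single i 1) (1 : K)) ∈ I

/-- The exponent vectors of the minimal monomial generators of a monomial ideal:
the monomials of `I` minimal with respect to divisibility. -/
def minGens {K : Type} [Field K] {n : ℕ} (I : Ideal (MvPolynomial (Fin n) K)) :
    Set (Fin n →₀ ℕ) := {a | a ∈ expSet I ∧ ∀ b ∈ expSet I, b ≤ a → b = a}

/-- `m(u)`: the largest index (1-based) of a variable dividing `x^a`; `0` if `a = 0`. -/
def mvar {n : ℕ} (a : Fin n →₀ ℕ) : ℕ := a.support.sup (fun i => (i : ℕ) + 1)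

/-- `m(I) = max { m(u) : u ∈ G(I) }`. -/
def mIdeal {K : Type} [Field K] {n : ℕ} (I : Ideal (MvPolynomial (Fin n) K)) : ℕ :=
  sSup {m | ∃ a ∈ minGens I, m = mvar a}

open MvPolynomial

/-- The `K`-subspace `Aᵢ·xᵢ` of `S`, where `Aᵢ` is the subalgebra generated by `B`. -/
def stSpace {K : Type} [Field K] {n : ℕ} (B : Finset (MvPolynomial (Fin n) K))
    (x : MvPolynomial (Fin n) K) : Submodule K (MvPolynomial (Fin n) K) :=
  (Subalgebra.toSubmodule (Algebra.adjoin K (B : Set (MvPolynomial (Fin n) K)))).map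
    (LinearMap.mulLeft K x)

/-- A standard graded Stanley decomposition of the ideal `I` with all Stanley spaces of
depth at least `k`: a finite family of graded algebra retracts `Sᵢ = K[Bᵢ]` (generated by
`k ≤ |Bᵢ|` linearly independent linear forms) and homogeneous elements `xᵢ ∈ I` with
`Sᵢ ∩ ann(xᵢ) = 0`, such that `I = ⊕ᵢ Sᵢ xᵢ` as graded `K`-vector spaces. -/
def StanleyDecomp1 {K : Type} [Field K] {n : ℕ} (I : Ideal (MvPolynomial (Fin n) K))
    (k : ℕ) : Prop :=
  ∃ (ι : Type) (_ : Fintype ι) (B : ι → Finset (MvPolynomial (Fin n) K))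
    (x : ι → MvPolynomial (Fin n) K) (d : ι → ℕ),
      (∀ i, ∀ b ∈ B i, b ∈ homogeneousSubmodule (Fin n) K 1) ∧
      (∀ i, LinearIndependent K (fun b : (B i : Set (MvPolynomial (Fin n) K)) =>
        (b : MvPolynomial (Fin n) K))) ∧
      (∀ i, k ≤ (B i).card) ∧
      (∀ i, x i ∈ I) ∧
      (∀ i, x i ∈ homogeneousSubmodule (Fin n) K (d i)) ∧
      (∀ i, ∀ a ∈ Algebra.adjoin K ((B i : Set (MvPolynomial (Fin n) K))),
        a * x i = 0 → a = 0) ∧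
      (iSup (fun i => stSpace (B i) (x i)) = Submodule.restrictScalars K I) ∧
      (iSupIndep fun i => stSpace (B i) (x i))

/-- The standard graded Stanley depth of `I`. -/
def sdepth1 {K : Type} [Field K] {n : ℕ} (I : Ideal (MvPolynomial (Fin n) K)) : ℕ∞ :=
  sSup {k : ℕ∞ | ∃ m : ℕ, StanleyDecomp1 I m ∧ k = m}

/-- The subspace `S₁ · V` of `S`. -/
def mulS1 {K : Type} [Field K] {n : ℕ} (V : Submodule K (MvPolynomial (Fin n) K)) :
    Submodule K (MvPolynomial (Fin n) K) :=
  Submodule.span K {p | ∃ l ∈ homogeneousSubmodule (Fin n) K 1, ∃ v ∈ V, p = l * v}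

/-- A lexsegment set of monomials of degree `d`. -/
def IsLexSet {n : ℕ} (d : ℕ) (L : Set (Fin n →₀ ℕ)) : Prop :=
  (∀ a ∈ L, edeg a = d) ∧ ∀ a ∈ L, ∀ b : Fin n →₀ ℕ, edeg b = d → lexGT b a → b ∈ L

/-- `V ⊆ S_d` is a Gotzmann space: `dim_K (S₁·V) = dim_K (S₁·lex(V))`, where `lex(V)` is
spanned by the lexsegment set of monomials of degree `d` of cardinality `dim_K V`. -/
def IsGotzmannSpace {K : Type} [Field K] {n : ℕ} (d : ℕ)
    (V : Submodule K (MvPolynomial (Fin n) K)) : Prop :=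
  ∃ L : Finset (Fin n →₀ ℕ), IsLexSet (n := n) d (L : Set (Fin n →₀ ℕ)) ∧ L.card = Module.finrank K ↥V ∧
    Module.finrank K ↥(mulS1 V) =
      Module.finrank K ↥(mulS1 (Submodule.span K
        ((fun a => (monomial a (1 : K))) '' (L : Set (Fin n →₀ ℕ)))))

/-- `I` is a homogeneous ideal in the standard grading. -/
def IsHomogeneousIdeal {K : Type} [Field K] {n : ℕ}
    (I : Ideal (MvPolynomial (Fin n) K)) : Prop :=
  ∀ p ∈ I, ∀ k : ℕ, homogeneousComponent k p ∈ I

/-- `I` is a Gotzmann ideal: each homogeneous component `I_k` is a Gotzmann space. -/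
def IsGotzmannIdeal {K : Type} [Field K] {n : ℕ}
    (I : Ideal (MvPolynomial (Fin n) K)) : Prop :=
  IsHomogeneousIdeal I ∧ ∀ k : ℕ,
    IsGotzmannSpace k ((Submodule.restrictScalars K I) ⊓ homogeneousSubmodule (Fin n) K k)

/-- `I` is generated by homogeneous elements of degree `d`. -/
def GenInDegHomog {K : Type} [Field K] {n : ℕ} (I : Ideal (MvPolynomial (Fin n) K))
    (d : ℕ) : Prop :=
  ∃ G : Set (MvPolynomial (Fin n) K), (∀ g ∈ G, g ∈ homogeneousSubmodule (Fin n) K d) ∧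
    I = Ideal.span G

/-- The value at `1` of the second difference of the Hilbert function, counted from degree `j`, of
the `j`-th power of the maximal ideal in `k + 1` variables. -/
def secondDiff (k j : ℕ) : ℤ := ((k + j).choose (j + 1) : ℤ) - (k + j).choose j

/-- `LexHilb k d h` describes recursively the functions `h` for which `t ↦ h t` is the Hilbert
function in degree `d + t` of a lexsegment ideal generated in degree `d` in `k + 1` variables. -/
inductive LexHilb : ℕ → ℕ → (ℕ → ℕ) → Prop
  | empty (k d : ℕ) : LexHilb k d fun _ => 0
  | pure (k d : ℕ) : LexHilb k d fun t => (k + t).choose t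
  | step {k j d : ℕ} {h : ℕ → ℕ} : j + 1 ≤ d → LexHilb k (j + 1) h →
      LexHilb (k + 1) d fun t => (k + 1 + (j + t)).choose (j + t) + h t

theorem succ_mul_secondDiff (k j : ℕ) :
    ((j : ℤ) + 1) * secondDiff k j = ((k : ℤ) - 1 - j) * (k + j).choose j := by
  have h := Nat.choose_succ_right_eq (k + j) j
  rw [Nat.add_sub_cancel] at h
  have h' : ((k + j).choose (j + 1) : ℤ) * (j + 1) = (k + j).choose j * k := by exact_mod_cast h
  unfold secondDiff
  linear_combination h'

theorem secondDiff_nonneg {k j : ℕ} (h : j + 1 ≤ k) : 0 ≤ secondDiff k j := by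
  have h1 := succ_mul_secondDiff k j
  have h2 : (0 : ℤ) ≤ ((k : ℤ) - 1 - j) * (k + j).choose j :=
    mul_nonneg (by omega) (by positivity)
  rw [← h1] at h2
  exact nonneg_of_mul_nonneg_right h2 (by positivity)

theorem secondDiff_nonpos {k j : ℕ} (h : k ≤ j + 1) : secondDiff k j ≤ 0 := by
  have h1 := succ_mul_secondDiff k j
  have h2 : ((k : ℤ) - 1 - j) * (k + j).choose j ≤ 0 :=
    mul_nonpos_of_nonpos_of_nonneg (by omega) (by positivity)
  rw [← h1] at h2
  exact nonpos_of_mul_nonpos_right h2 (by positivity)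

theorem secondDiff_succ_succ (k j : ℕ) :
    secondDiff (k + 1) (j + 1) = secondDiff (k + 1) j + secondDiff k (j + 1) := by
  unfold secondDiff
  have h1 := Nat.choose_succ_succ (k + (j + 1)) (j + 1)
  have h2 := Nat.choose_succ_succ (k + (j + 1)) j
  rw [show k + 1 + (j + 1) = (k + (j + 1)).succ by omega, h1, show j + 1 = j.succ from rfl, h2,
    show k + 1 + j = k + j.succ by omega]
  push_cast
  ring

theorem choose_sub_two_mul (k j : ℕ) :
    ((k + (j + 1)).choose (j + 1) : ℤ) - 2 * (k + j).choose j = secondDiff k j := by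
  unfold secondDiff
  rw [← add_assoc, Nat.choose_succ_succ' (k + j) j]
  push_cast
  ring

theorem secondDiff_antitone {k i j : ℕ} (hi : k ≤ i + 1) (hij : i ≤ j) :
    secondDiff k j ≤ secondDiff k i := by
  induction j, hij using Nat.le_induction with
  | base => exact le_rfl
  | succ j hij ih =>
    cases k with
    | zero => simp [secondDiff]
    | succ k =>
      rw [secondDiff_succ_succ]
      have := secondDiff_nonpos (k := k) (j := j + 1) (by omega)
      omega

theorem secondDiff_monotone {k i j : ℕ} (hij : i ≤ j) (hj : j + 2 ≤ k) :
    secondDiff k i ≤ secondDiff k j := by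
  induction j, hij using Nat.le_induction with
  | base => exact le_rfl
  | succ j hij ih =>
    obtain ⟨k, rfl⟩ : ∃ l, k = l + 1 := ⟨k - 1, by omega⟩
    rw [secondDiff_succ_succ]
    have := secondDiff_nonneg (k := k) (j := j + 1) (by omega)
    have := ih (by omega)
    omega

theorem secondDiff_self (k : ℕ) : secondDiff k k = -(catalan k : ℤ) := by
  have h1 := succ_mul_secondDiff k k
  have h2 := succ_mul_catalan_eq_centralBinom k
  rw [Nat.centralBinom, two_mul] at h2
  have h3 : ((k : ℤ) + 1) * catalan k = (k + k).choose k := by exact_mod_cast h2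
  have h4 : ((k : ℤ) + 1) * secondDiff k k = (k + 1) * -(catalan k : ℤ) := by
    rw [h1, ← h3]; ring
  exact mul_left_cancel₀ (by positivity) h4

theorem secondDiff_succ_self (k : ℕ) : secondDiff (k + 1) k = 0 := by
  have h1 := secondDiff_nonneg (k := k + 1) (j := k) le_rfl
  have h2 := secondDiff_nonpos (k := k + 1) (j := k) le_rfl
  omega

theorem secondDiff_succ_le_catalan (k j : ℕ) : secondDiff (k + 1) j ≤ catalan k := by
  by_cases hj : k ≤ j
  · have := secondDiff_nonpos (k := k + 1) (j := j) (by omega)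
    omega
  · obtain ⟨k, rfl⟩ : ∃ l, k = l + 1 := ⟨k - 1, by omega⟩
    have h1 := secondDiff_monotone (k := k + 1 + 1) (i := j) (j := k) (by omega) (by omega)
    have h2 := secondDiff_succ_succ (k + 1) k
    rw [secondDiff_succ_self, secondDiff_self] at h2
    omega

theorem catalan_recurrence (k : ℕ) :
    (k + 2) * catalan (k + 1) = 2 * (2 * k + 1) * catalan k := by
  have h1 := succ_mul_catalan_eq_centralBinom k
  have h2 := succ_mul_catalan_eq_centralBinom (k + 1)
  have h3 := Nat.succ_mul_centralBinom_succ k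
  rw [← h1, ← h2] at h3
  have : (k + 1) * ((k + 2) * catalan (k + 1)) = (k + 1) * (2 * (2 * k + 1) * catalan k) := by
    linarith
  exact Nat.eq_of_mul_eq_mul_left (by omega) this

theorem catalan_le_succ (k : ℕ) : catalan k ≤ catalan (k + 1) := by
  have := catalan_recurrence k
  by_contra! hlt
  nlinarith

theorem two_mul_catalan_le (k : ℕ) : 2 * catalan (k + 1) ≤ catalan (k + 2) := by
  have := catalan_recurrence (k + 1)
  by_contra! hlt
  nlinarith

theorem lt_catalan_succ (k : ℕ) : k < catalan (k + 1) := by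
  induction k with
  | zero => simp
  | succ k ih =>
    have := two_mul_catalan_le k
    show k + 1 < catalan (k + 2)
    omega

theorem xi_succ (k : ℕ) : xi (k + 1) = xi k + (k + 1 + k).choose k := by
  unfold xi
  rw [Finset.sum_Icc_succ_top (by omega), show 2 * (k + 1) - 1 = k + 1 + k by omega,
    Nat.choose_symm_add]

theorem choose_succ_add_self (k : ℕ) :
    (k + 1 + (k + 1)).choose (k + 1) = 2 * (k + 1 + k).choose k := by
  rw [← add_assoc, Nat.choose_succ_succ' (k + 1 + k) k, Nat.choose_symm_add, two_mul]

theorem choose_add_mono {k i j : ℕ} (h : i ≤ j) : (k + i).choose i ≤ (k + j).choose j := by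
  rw [← Nat.choose_symm_add, ← Nat.choose_symm_add]
  exact Nat.choose_le_choose k (by omega)

theorem xi_lt (k : ℕ) : xi k < (k + 1 + k).choose k := by
  induction k with
  | zero => simp [xi]
  | succ k ih =>
    rw [xi_succ]
    have h1 := choose_succ_add_self k
    have h2 : (k + 1 + (k + 1)).choose (k + 1) ≤ (k + 1 + 1 + (k + 1)).choose (k + 1) :=
      Nat.choose_le_choose _ (by omega)
    omega

theorem LexHilb.zero_le_choose {k d : ℕ} {h : ℕ → ℕ} (hh : LexHilb k d h) :
    h 0 ≤ (k + d).choose d := by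
  induction hh with
  | empty => simp
  | pure k d => simpa using Nat.succ_le_of_lt (Nat.choose_pos (Nat.le_add_left d k))
  | @step k j d h hj _ ih =>
    calc (k + 1 + (j + 0)).choose (j + 0) + h 0
        ≤ (k + (j + 1)).choose j + (k + (j + 1)).choose (j + 1) := by
          rw [show k + 1 + (j + 0) = k + (j + 1) by omega]; simpa using ih
      _ = (k + 1 + (j + 1)).choose (j + 1) := by
          rw [show k + 1 + (j + 1) = k + (j + 1) + 1 by omega, Nat.choose_succ_succ']
      _ ≤ _ := choose_add_mono hj

theorem choose_le_xi {k j : ℕ} (h : j + 1 ≤ k) : (k + j).choose j ≤ xi k := by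
  obtain ⟨k, rfl⟩ : ∃ l, k = l + 1 := ⟨k - 1, by omega⟩
  rw [xi_succ]
  have := choose_add_mono (k := k + 1) (i := j) (j := k) (by omega)
  omega

theorem LexHilb.growth {k d : ℕ} {h : ℕ → ℕ} (hh : LexHilb k d h) :
    (0 ≤ (h 1 : ℤ) - 2 * h 0 ↔ h 0 ≤ xi k) ∧
      (k ≤ d → secondDiff k d ≤ (h 1 : ℤ) - 2 * h 0) ∧
      (h 1 : ℤ) - 2 * h 0 < catalan (k + 1) := by
  induction hh with
  | empty k d =>
    refine ⟨by simp, fun hk => ?_, ?_⟩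
    · simpa using secondDiff_nonpos (k := k) (j := d) (by omega)
    · have := lt_catalan_succ k
      simp; omega
  | pure k d =>
    have := lt_catalan_succ k
    simp only [add_zero, Nat.choose_zero_right, Nat.choose_one_right]
    refine ⟨?_, fun hk => ?_, by push_cast; omega⟩
    · cases k with
      | zero => simp [xi]
      | succ k =>
        have := choose_le_xi (k := k + 1) (j := 0) (by omega)
        simp at this
        push_cast
        constructor <;> intros <;> omega
    · cases k with
      | zero => simp [secondDiff]
      | succ k =>
        have := secondDiff_nonpos (k := k + 1) (j := d) (by omega)
        push_cast; omega
  | @step k j d h hj hh ih =>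
    obtain ⟨ih1, ih2, ih3⟩ := ih
    have hcard := hh.zero_le_choose
    have hdiff := choose_sub_two_mul (k + 1) j
    have hpas : (k + 1 + (j + 1)).choose (j + 1) =
        (k + 1 + j).choose j + (k + (j + 1)).choose (j + 1) := by
      rw [show k + 1 + (j + 1) = k + (j + 1) + 1 by omega, Nat.choose_succ_succ',
        show k + 1 + j = k + (j + 1) by omega]
    have hrec := secondDiff_succ_succ k j
    have hF : (((k + 1 + (j + 1)).choose (j + 1) + h 1 : ℕ) : ℤ) -
        2 * ((k + 1 + (j + 0)).choose (j + 0) + h 0 : ℕ) =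
        secondDiff (k + 1) j + ((h 1 : ℤ) - 2 * h 0) := by
      rw [← hdiff, add_zero]; push_cast; ring
    simp only [hF]
    simp only [add_zero]
    set F : ℤ := (h 1 : ℤ) - 2 * h 0
    have hsmall : j + 2 ≤ k → 0 ≤ F := fun hjk =>
      ih1.2 (hcard.trans (choose_le_xi (by omega)))
    refine ⟨?_, fun hk => ?_, ?_⟩
    · rw [xi_succ]
      rcases lt_trichotomy j k with hlt | rfl | hgt
      · have h1 : (k + 1 + (j + 1)).choose (j + 1) ≤ (k + 1 + k).choose k :=
          choose_add_mono (by omega)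
        have h2 : 0 ≤ secondDiff (k + 1) j + F := by
          by_cases hjk : j + 2 ≤ k
          · have := secondDiff_nonneg (k := k + 1) (j := j) (by omega)
            have := hsmall hjk
            omega
          · obtain rfl : k = j + 1 := by omega
            have := ih2 le_rfl
            rw [secondDiff_succ_self] at hrec
            omega
        constructor <;> intros <;> omega
      · rw [secondDiff_succ_self, zero_add, ih1]
        omega
      · have h1 := secondDiff_antitone (k := k + 1) (i := k + 1) (j := j) (by omega) (by omega)
        rw [secondDiff_self] at h1
        have h2 := choose_add_mono (k := k + 1) (i := k + 1) (j := j) (by omega)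
        rw [choose_succ_add_self] at h2
        have := xi_lt k
        constructor <;> intros <;> omega
    · by_cases hjk : j + 2 ≤ k
      · have := secondDiff_nonneg (k := k + 1) (j := j) (by omega)
        have := hsmall hjk
        have := secondDiff_nonpos (k := k + 1) (j := d) (by omega)
        omega
      · have := ih2 (by omega)
        have := secondDiff_antitone (k := k + 1) (i := j + 1) (j := d) (by omega) (by omega)
        omega
    · have h1 := secondDiff_succ_le_catalan k j
      have h2 := catalan_le_succ k
      have h3 := two_mul_catalan_le k
      show _ < (catalan (k + 2) : ℤ)
      omega

/-! ### Exponent vectors -/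

theorem edeg_cons {n : ℕ} (y : ℕ) (s : Fin n →₀ ℕ) : edeg (Finsupp.cons y s) = y + edeg s := by
  simp [edeg, Fin.sum_univ_succ]

theorem edeg_add {n : ℕ} (a b : Fin n →₀ ℕ) : edeg (a + b) = edeg a + edeg b := by
  simp [edeg, Finset.sum_add_distrib]

theorem edeg_single {n : ℕ} (i : Fin n) (c : ℕ) : edeg (Finsupp.single i c) = c := by
  simp [edeg, Finsupp.single_apply]

theorem edeg_mono {n : ℕ} {a b : Fin n →₀ ℕ} (h : a ≤ b) : edeg a ≤ edeg b :=
  Finset.sum_le_sum fun i _ => h i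

theorem eq_of_le_of_edeg_eq {n : ℕ} {a b : Fin n →₀ ℕ} (h : a ≤ b) (he : edeg a = edeg b) :
    a = b := by
  ext i
  exact (Finset.sum_eq_sum_iff_of_le fun i _ => h i).1 he i (Finset.mem_univ i)

theorem edeg_eq_degree {n : ℕ} (a : Fin n →₀ ℕ) : edeg a = a.degree := by
  simp [edeg, Finsupp.degree_eq_sum]

theorem setOf_edeg_eq {n e : ℕ} :
    {b : Fin n →₀ ℕ | edeg b = e} = ↑(Finset.finsuppAntidiag (Finset.univ : Finset (Fin n)) e) := by
  ext b
  simp [edeg]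

theorem finite_setOf_edeg_eq (n e : ℕ) : {b : Fin n →₀ ℕ | edeg b = e}.Finite := by
  rw [setOf_edeg_eq]
  exact Finset.finite_toSet _

theorem ncard_setOf_edeg_eq (k e : ℕ) :
    {b : Fin (k + 1) →₀ ℕ | edeg b = e}.ncard = (k + e).choose e := by
  rw [setOf_edeg_eq, Set.ncard_coe_finset, Finset.card_finsuppAntidiag_nat_eq_choose]
  simp [Nat.add_right_comm]

theorem ncard_setOf_edeg_eq_le_apply_zero (k c e : ℕ) :
    {b : Fin (k + 1) →₀ ℕ | edeg b = c + e ∧ c ≤ b 0}.ncard = (k + e).choose e := by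
  rw [← ncard_setOf_edeg_eq, ← Set.ncard_image_of_injective {b : Fin (k + 1) →₀ ℕ | edeg b = e}
    (add_left_injective (Finsupp.single (0 : Fin (k + 1)) c))]
  congr 1
  ext b
  constructor
  · rintro ⟨hb, hc⟩
    have hle : Finsupp.single 0 c ≤ b := Finsupp.single_le_iff.2 hc
    refine ⟨b - Finsupp.single 0 c, ?_, tsub_add_cancel_of_le hle⟩
    have := edeg_add (b - Finsupp.single 0 c) (Finsupp.single 0 c)
    rw [tsub_add_cancel_of_le hle, edeg_single] at this
    simp only [Set.mem_ofPred_eq]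
    omega
  · rintro ⟨a, ha, rfl⟩
    simp only [Set.mem_ofPred_eq] at ha
    simp [edeg_add, edeg_single, ha, add_comm]

theorem exists_le_le_edeg_eq {n e : ℕ} {c b : Fin n →₀ ℕ} (hcb : c ≤ b) (hc : edeg c ≤ e)
    (hb : e ≤ edeg b) : ∃ a, c ≤ a ∧ a ≤ b ∧ edeg a = e := by
  induction e, hc using Nat.le_induction with
  | base => exact ⟨c, le_rfl, hcb, rfl⟩
  | succ e _ ih =>
    obtain ⟨a, hca, hab, rfl⟩ := ih (by omega)
    obtain ⟨i, hi⟩ : ∃ i, a i < b i := by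
      by_contra! h
      have := edeg_mono (show b ≤ a from h)
      omega
    refine ⟨a + Finsupp.single i 1, hca.trans le_self_add, fun j => ?_, ?_⟩
    · by_cases hj : i = j
      · subst hj; simpa using hi
      · simpa [Finsupp.single_apply, hj] using hab j
    · rw [edeg_add, edeg_single]

/-- The exponent vectors of degree `e` in the monomial ideal generated by `L`. -/
def multiplesOfDegree {n : ℕ} (L : Set (Fin n →₀ ℕ)) (e : ℕ) : Set (Fin n →₀ ℕ) :=
  {b | edeg b = e ∧ ∃ a ∈ L, a ≤ b}

theorem IsLexSet.tail {n d p : ℕ} {L : Set (Fin (n + 1) →₀ ℕ)} (hL : IsLexSet d L) (hp : p ≤ d) :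
    IsLexSet (d - p) {a | Finsupp.cons p a ∈ L} := by
  refine ⟨fun a ha => ?_, fun a ha b hb hlex => ?_⟩
  · have := hL.1 _ ha
    rw [edeg_cons] at this
    omega
  · refine hL.2 _ ha _ (by rw [edeg_cons]; omega) ?_
    obtain ⟨i, hi, hlt⟩ := hlex
    refine ⟨i.succ, fun j => ?_, by simpa using hlt⟩
    refine Fin.cases (by simp) (fun j hj => ?_) j
    simpa using hi j (by simpa using hj)

theorem multiplesOfDegree_eq_union {n d p : ℕ} {L : Set (Fin (n + 1) →₀ ℕ)} (hL : IsLexSet d L)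
    (hp : p + 1 ≤ d) (hex : ∃ a ∈ L, a 0 = p) (hmin : ∀ a ∈ L, p ≤ a 0) (t : ℕ) :
    multiplesOfDegree L (d + t) = {b | edeg b = d + t ∧ p + 1 ≤ b 0} ∪
      Finsupp.cons p '' multiplesOfDegree {a | Finsupp.cons p a ∈ L} (d - p + t) := by
  obtain ⟨a₀, ha₀, rfl⟩ := hex
  ext b
  constructor
  · rintro ⟨hb, a, ha, hab⟩
    by_cases hlt : a₀ 0 + 1 ≤ b 0
    · exact Or.inl ⟨hb, hlt⟩
    · right
      have h1 := hmin a ha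
      have h2 : a 0 ≤ b 0 := hab 0
      have hb0 : b 0 = a₀ 0 := by omega
      have ha0 : a 0 = a₀ 0 := by omega
      have hcb : Finsupp.cons (a₀ 0) b.tail = b := by rw [← hb0, Finsupp.cons_tail]
      refine ⟨b.tail, ⟨?_, a.tail, ?_, fun i => hab i.succ⟩, hcb⟩
      · have := edeg_cons (a₀ 0) b.tail
        rw [hcb] at this
        omega
      · simpa [← ha0, Finsupp.cons_tail] using ha
  · rintro (⟨hb, hlt⟩ | ⟨b', ⟨hb', a', ha', hab⟩, rfl⟩)
    · refine ⟨hb, ?_⟩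
      obtain ⟨a, hca, hab, ha⟩ := exists_le_le_edeg_eq (e := d)
        (Finsupp.single_le_iff.2 hlt : Finsupp.single 0 (a₀ 0 + 1) ≤ b)
        (by rwa [edeg_single]) (by omega)
      refine ⟨a, hL.2 a₀ ha₀ a ha ⟨0, fun j hj => absurd hj (Fin.not_lt_zero j), ?_⟩, hab⟩
      have := hca 0
      rw [Finsupp.single_eq_same] at this
      omega
    · refine ⟨by rw [edeg_cons]; omega, _, ha', fun i => ?_⟩
      refine Fin.cases (by simp) (fun i => ?_) i
      simpa using hab i

theorem ncard_multiplesOfDegree_step {k d p : ℕ} {L : Set (Fin (k + 2) →₀ ℕ)} (hL : IsLexSet d L)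
    (hp : p + 1 ≤ d) (hex : ∃ a ∈ L, a 0 = p) (hmin : ∀ a ∈ L, p ≤ a 0) (t : ℕ) :
    (multiplesOfDegree L (d + t)).ncard =
      (k + 1 + (d - p - 1 + t)).choose (d - p - 1 + t) +
        (multiplesOfDegree {a | Finsupp.cons p a ∈ L} (d - p + t)).ncard := by
  rw [multiplesOfDegree_eq_union hL hp hex hmin, Set.ncard_union_eq ?_ ?_ ?_]
  · rw [Set.ncard_image_of_injective _ (Finsupp.cons_right_injective p),
      ← ncard_setOf_edeg_eq_le_apply_zero (k + 1) (p + 1) (d - p - 1 + t)]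
    congr 3
    ext b
    constructor <;> rintro ⟨h1, h2⟩ <;> exact ⟨by omega, h2⟩
  · rw [Set.disjoint_left]
    rintro _ ⟨_, h⟩ ⟨b, _, rfl⟩
    simp at h
  · exact (finite_setOf_edeg_eq _ (d + t)).subset fun b hb => hb.1
  · exact ((finite_setOf_edeg_eq _ (d - p + t)).subset fun b hb => hb.1).image _

theorem multiplesOfDegree_eq_of_le_apply_zero {n d : ℕ} {L : Set (Fin (n + 1) →₀ ℕ)}
    (hL : IsLexSet d L) (hne : L.Nonempty) (hmin : ∀ a ∈ L, d ≤ a 0) (t : ℕ) :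
    multiplesOfDegree L (d + t) = {b | edeg b = d + t ∧ d ≤ b 0} := by
  have key : ∀ a ∈ L, a = Finsupp.single 0 d := fun a ha =>
    (eq_of_le_of_edeg_eq (by simpa [Finsupp.single_le_iff] using hmin a ha)
      (by rw [edeg_single, hL.1 a ha])).symm
  obtain ⟨a, ha⟩ := hne
  ext b
  constructor
  · rintro ⟨hb, a, ha, hab⟩
    exact ⟨hb, (hmin a ha).trans (hab 0)⟩
  · rintro ⟨hb, h0⟩
    refine ⟨hb, a, ha, ?_⟩
    rw [key a ha]
    simpa [Finsupp.single_le_iff] using h0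

theorem IsLexSet.lexHilb {k d : ℕ} {L : Set (Fin (k + 1) →₀ ℕ)} (hL : IsLexSet d L) :
    LexHilb k d fun t => (multiplesOfDegree L (d + t)).ncard := by
  induction k generalizing d with
  | zero =>
    rcases L.eq_empty_or_nonempty with rfl | hne
    · simpa [multiplesOfDegree] using LexHilb.empty 0 d
    · have hmin : ∀ a ∈ L, d ≤ a 0 := fun a ha => by simpa [edeg] using (hL.1 a ha).ge
      simp only [multiplesOfDegree_eq_of_le_apply_zero hL hne hmin,
        ncard_setOf_edeg_eq_le_apply_zero]
      exact LexHilb.pure 0 d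
  | succ k ih =>
    rcases L.eq_empty_or_nonempty with rfl | hne
    · simpa [multiplesOfDegree] using LexHilb.empty (k + 1) d
    · obtain ⟨a₀, ha₀, hmin⟩ := exists_minimalFor_of_wellFoundedLT (· ∈ L) (fun a => a 0) hne
      replace hmin : ∀ a ∈ L, a₀ 0 ≤ a 0 := fun a ha => by
        by_contra! h
        exact absurd (hmin ha h.le) (by simpa using h)
      by_cases hp : a₀ 0 + 1 ≤ d
      · simp only [ncard_multiplesOfDegree_step hL hp ⟨a₀, ha₀, rfl⟩ hmin]
        refine LexHilb.step (by omega) ?_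
        rw [show d - a₀ 0 - 1 + 1 = d - a₀ 0 by omega]
        exact ih (hL.tail (by omega))
      · have hmin' : ∀ a ∈ L, d ≤ a 0 := fun a ha => le_trans (by omega) (hmin a ha)
        simp only [multiplesOfDegree_eq_of_le_apply_zero hL hne hmin',
          ncard_setOf_edeg_eq_le_apply_zero]
        exact LexHilb.pure (k + 1) d


/-! ### Hilbert decompositions of numerical functions -/

/-- `f` is a finite sum of Hilbert functions of shifted polynomial rings in at least `k`
variables. -/
def IsPolySum (k : ℕ) (f : ℤ → ℕ) : Prop :=
  ∃ (ι : Type) (_ : Fintype ι) (dd : ι → ℕ) (s : ι → ℤ),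
    (∀ i, k ≤ dd i) ∧ ∀ j : ℤ, f j = ∑ i, polyHilb (dd i) (j - s i)

theorem IsPolySum.zero (k : ℕ) : IsPolySum k fun _ => 0 :=
  ⟨Empty, inferInstance, Empty.elim, Empty.elim, fun i => i.elim, fun j => by simp⟩

theorem IsPolySum.add {k : ℕ} {f g : ℤ → ℕ} (hf : IsPolySum k f) (hg : IsPolySum k g) :
    IsPolySum k fun t => f t + g t := by
  obtain ⟨ι, _, dd, s, h1, h2⟩ := hf
  obtain ⟨κ, _, ee, r, h3, h4⟩ := hg
  refine ⟨ι ⊕ κ, inferInstance, Sum.elim dd ee, Sum.elim s r, ?_, fun j => ?_⟩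
  · rintro (i | i)
    exacts [h1 i, h3 i]
  · simp [Fintype.sum_sum_type, h2, h4]

theorem IsPolySum.polyHilb {k m : ℕ} (h : k ≤ m) : IsPolySum k (polyHilb m) :=
  ⟨Unit, inferInstance, fun _ => m, fun _ => 0, fun _ => h, fun j => by simp⟩

theorem IsPolySum.shift {k : ℕ} {f : ℤ → ℕ} (hf : IsPolySum k f) (c : ℤ) :
    IsPolySum k fun t => f (t - c) := by
  obtain ⟨ι, _, dd, s, h1, h2⟩ := hf
  refine ⟨ι, inferInstance, dd, fun i => s i + c, h1, fun j => ?_⟩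
  simp only [h2, sub_sub, add_comm c]

theorem IsPolySum.mul {k : ℕ} {f : ℤ → ℕ} (hf : IsPolySum k f) (c : ℕ) :
    IsPolySum k fun t => c * f t := by
  induction c with
  | zero => simpa using IsPolySum.zero k
  | succ c ih => simpa [add_mul] using ih.add hf

theorem IsPolySum.sum {k : ℕ} {ι : Type*} (s : Finset ι) {f : ι → ℤ → ℕ}
    (hf : ∀ i ∈ s, IsPolySum k (f i)) : IsPolySum k fun t => ∑ i ∈ s, f i t := by
  classical
  induction s using Finset.induction_on with
  | empty => simpa using IsPolySum.zero k
  | insert a s ha ih =>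
    simp only [Finset.sum_insert ha]
    exact (hf a (by simp)).add (ih fun i hi => hf i (by simp [hi]))

theorem IsPolySum.mono {k l : ℕ} (h : k ≤ l) {f : ℤ → ℕ} (hf : IsPolySum l f) : IsPolySum k f := by
  obtain ⟨ι, _, dd, s, h1, h2⟩ := hf
  exact ⟨ι, inferInstance, dd, s, fun i => h.trans (h1 i), h2⟩

theorem polyHilb_of_neg (m : ℕ) {t : ℤ} (h : t < 0) : polyHilb m t = 0 := by
  simp [polyHilb, h]

theorem polyHilb_succ_natCast (m t : ℕ) : polyHilb (m + 1) t = (m + t).choose t := by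
  rw [polyHilb, if_neg (by omega), if_neg (by omega), Int.toNat_natCast, Nat.add_sub_cancel,
    add_comm t m, Nat.choose_symm_add]

theorem polyHilb_zero_pos (m : ℕ) : 0 < polyHilb m 0 := by
  simp only [polyHilb]
  split_ifs <;> simp_all

theorem polyHilb_recurrence (m : ℕ) (t : ℤ) :
    polyHilb (m + 2) t = polyHilb (m + 1) t + polyHilb (m + 2) (t - 1) := by
  rcases lt_or_ge t 0 with h | h
  · simp [polyHilb_of_neg, h, show t - 1 < 0 by omega]
  · obtain ⟨t, rfl⟩ := Int.eq_ofNat_of_zero_le h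
    cases t with
    | zero => simpa [polyHilb_of_neg] using
        (polyHilb_succ_natCast (m + 1) 0).trans (by simpa using (polyHilb_succ_natCast m 0).symm)
    | succ t =>
      rw [show ((t + 1 : ℕ) : ℤ) - 1 = (t : ℤ) by push_cast; ring, polyHilb_succ_natCast,
        polyHilb_succ_natCast, polyHilb_succ_natCast,
        show m + 1 + (t + 1) = m + (t + 1) + 1 by omega, Nat.choose_succ_succ',
        show m + 1 + t = m + (t + 1) by omega, add_comm]

theorem exists_polyHilb_eq_add (m : ℕ) :
    ∃ g, IsPolySum 2 g ∧ ∀ t, polyHilb (m + 2) t = polyHilb 2 t + g t := by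
  induction m with
  | zero => exact ⟨_, IsPolySum.zero 2, fun t => rfl⟩
  | succ m ih =>
    obtain ⟨g, hg, h⟩ := ih
    refine ⟨_, hg.add ((IsPolySum.polyHilb (m := m + 3) (by omega)).shift 1), fun t => ?_⟩
    rw [polyHilb_recurrence, h, add_assoc]

theorem exists_polyHilb_eq_add_mul_add (m : ℕ) :
    ∃ g, IsPolySum 2 g ∧
      ∀ t, polyHilb (m + 2) t = polyHilb 2 t + m * polyHilb 2 (t - 1) + g t := by
  induction m with
  | zero => exact ⟨_, IsPolySum.zero 2, fun t => by simp⟩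
  | succ m ih =>
    obtain ⟨g, hg, h⟩ := ih
    obtain ⟨g', hg', h'⟩ := exists_polyHilb_eq_add (m + 1)
    refine ⟨_, hg.add (hg'.shift 1), fun t => ?_⟩
    have h1 := polyHilb_recurrence (m + 1) t
    have h2 := h t
    have h3 := h' (t - 1)
    rw [h1, h2, h3, add_mul]
    ring

theorem isPolySum_two_of_le {k : ℕ} {c : ℕ → ℕ} (h : c 0 ≤ ∑ m ∈ Finset.range k, c (m + 1) * m) :
    IsPolySum 2 fun t => ∑ i ∈ Finset.range (k + 1), c i * polyHilb (i + 1) t := by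
  choose g hg hP using exists_polyHilb_eq_add_mul_add
  obtain ⟨e, he⟩ := Nat.exists_eq_add_of_le h
  have h2 := IsPolySum.polyHilb (k := 2) (m := 2) le_rfl
  have H := (((h2.mul (c 0 + ∑ m ∈ Finset.range k, c (m + 1))).add ((h2.shift 1).mul e)).add
    (IsPolySum.sum (Finset.range k) fun m _ => (hg m).mul (c (m + 1))))
  convert H using 2 with t
  rw [Finset.sum_range_succ']
  have h3 : ∑ m ∈ Finset.range k, c (m + 1) * polyHilb (m + 1 + 1) t =
      (∑ m ∈ Finset.range k, c (m + 1)) * polyHilb 2 t +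
        (∑ m ∈ Finset.range k, c (m + 1) * m) * polyHilb 2 (t - 1) +
        ∑ m ∈ Finset.range k, c (m + 1) * g m t := by
    rw [Finset.sum_mul, Finset.sum_mul, ← Finset.sum_add_distrib, ← Finset.sum_add_distrib]
    refine Finset.sum_congr rfl fun m _ => ?_
    rw [hP m t]
    ring
  have h4 : polyHilb 2 t = polyHilb 1 t + polyHilb 2 (t - 1) := polyHilb_recurrence 0 t
  rw [h3, he, zero_add]
  zify at h4 ⊢
  linear_combination -(c 0 : ℤ) * h4

theorem choose_add_eq_sum (k j : ℕ) :
    ∃ c : ℕ → ℕ, ∀ t, (k + (j + t)).choose (j + t) =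
      ∑ i ∈ Finset.range (k + 1), c i * polyHilb (i + 1) (t : ℕ) := by
  induction k generalizing j with
  | zero => exact ⟨fun _ => 1, fun t => by simp [polyHilb_succ_natCast 0 t]⟩
  | succ k ihk =>
    induction j with
    | zero =>
      refine ⟨fun i => if i = k + 1 then 1 else 0, fun t => ?_⟩
      simp [polyHilb_succ_natCast (k + 1) t]
    | succ j ihj =>
      obtain ⟨c, hc⟩ := ihj
      obtain ⟨c', hc'⟩ := ihk (j + 1)
      refine ⟨fun i => c i + if i ≤ k then c' i else 0, fun t => ?_⟩
      have h1 : ∑ i ∈ Finset.range (k + 1 + 1), (if i ≤ k then c' i else 0) *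
          polyHilb (i + 1) (t : ℕ) = ∑ i ∈ Finset.range (k + 1), c' i * polyHilb (i + 1) (t : ℕ) := by
        rw [Finset.sum_range_succ, if_neg (by omega), zero_mul, add_zero]
        refine Finset.sum_congr rfl fun i hi => ?_
        rw [if_pos (by simpa [Nat.lt_succ_iff] using hi)]
      simp only [add_mul, Finset.sum_add_distrib, h1, ← hc, ← hc']
      rw [show k + 1 + (j + 1 + t) = k + (j + 1 + t) + 1 by omega,
        show j + 1 + t = j + t + 1 by omega, Nat.choose_succ_succ',
        show k + 1 + (j + t) = k + (j + t + 1) by omega]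

theorem LexHilb.exists_eq_sum {k d : ℕ} {h : ℕ → ℕ} (hh : LexHilb k d h) :
    ∃ c : ℕ → ℕ, ∀ t, h t = ∑ i ∈ Finset.range (k + 1), c i * polyHilb (i + 1) (t : ℕ) := by
  induction hh with
  | empty => exact ⟨fun _ => 0, fun t => by simp⟩
  | pure k d => simpa using choose_add_eq_sum k 0
  | @step k j d h _ _ ih =>
    obtain ⟨c, hc⟩ := choose_add_eq_sum (k + 1) j
    obtain ⟨c', hc'⟩ := ih
    refine ⟨fun i => c i + if i ≤ k then c' i else 0, fun t => ?_⟩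
    have h1 : ∑ i ∈ Finset.range (k + 1 + 1), (if i ≤ k then c' i else 0) *
        polyHilb (i + 1) (t : ℕ) = ∑ i ∈ Finset.range (k + 1), c' i * polyHilb (i + 1) (t : ℕ) := by
      rw [Finset.sum_range_succ, if_neg (by omega), zero_mul, add_zero]
      refine Finset.sum_congr rfl fun i hi => ?_
      rw [if_pos (by simpa [Nat.lt_succ_iff] using hi)]
    simp only [add_mul, Finset.sum_add_distrib, h1, ← hc, ← hc']

theorem two_mul_polyHilb_le {m : ℕ} (hm : 2 ≤ m) {t : ℤ} (ht : t ≤ 0) :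
    2 * polyHilb m t ≤ polyHilb m (t + 1) := by
  obtain ⟨m, rfl⟩ : ∃ l, m = l + 1 := ⟨m - 1, by omega⟩
  rcases ht.lt_or_eq with ht | rfl
  · simp [polyHilb_of_neg _ ht]
  · have h0 := polyHilb_succ_natCast m 0
    have h1 := polyHilb_succ_natCast m 1
    simp at h0 h1
    simp [h0, h1]
    omega

theorem IsPolySum.two_mul_le {f : ℤ → ℕ} (hf : IsPolySum 2 f) {d : ℤ} (h0 : ∀ j < d, f j = 0) :
    2 * f d ≤ f (d + 1) := by
  obtain ⟨ι, _, dd, s, h1, h2⟩ := hf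
  rw [h2, h2, Finset.mul_sum]
  refine Finset.sum_le_sum fun i _ => ?_
  have hs : d ≤ s i := by
    by_contra! hlt
    have h3 := h0 _ hlt
    rw [h2, Finset.sum_eq_zero_iff] at h3
    have h4 := h3 i (Finset.mem_univ i)
    rw [sub_self] at h4
    exact (polyHilb_zero_pos (dd i)).ne' h4
  have := two_mul_polyHilb_le (h1 i) (t := d - s i) (by omega)
  rwa [show d + 1 - s i = d - s i + 1 by ring]

theorem LexHilb.isPolySum_iff {k d : ℕ} {h : ℕ → ℕ} (hh : LexHilb k d h) {f : ℤ → ℕ} {e : ℕ}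
    (hneg : ∀ j < (e : ℤ), f j = 0) (hf : ∀ t : ℕ, f (e + t) = h t) :
    IsPolySum 1 f ∧ (IsPolySum 2 f ↔ h 0 ≤ xi k) := by
  obtain ⟨c, hc⟩ := hh.exists_eq_sum
  have hfc : f = fun j => ∑ i ∈ Finset.range (k + 1), c i * polyHilb (i + 1) (j - e) := by
    ext j
    rcases lt_or_ge j e with hj | hj
    · simp [hneg j hj, polyHilb_of_neg _ (sub_neg.2 hj)]
    · obtain ⟨t, ht⟩ := Int.eq_ofNat_of_zero_le (sub_nonneg.2 hj)
      obtain rfl : j = e + t := by omega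
      rw [hf, hc, add_sub_cancel_left]
  refine ⟨?_, fun H => ?_, fun H => ?_⟩
  · rw [hfc]
    exact (IsPolySum.sum _ fun i _ =>
      (IsPolySum.polyHilb (k := 1) (m := i + 1) (by omega)).mul (c i)).shift e
  · have := H.two_mul_le hneg
    rw [← hh.growth.1]
    have h0 := hf 0
    have h1 := hf 1
    simp only [Nat.cast_zero, add_zero, Nat.cast_one] at h0 h1
    omega
  · rw [hfc]
    refine (isPolySum_two_of_le ?_).shift e
    have h2 := hh.growth.1.2 H
    have hP0 : ∀ i, polyHilb (i + 1) ((0 : ℕ) : ℤ) = 1 := fun i => by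
      rw [polyHilb_succ_natCast, Nat.choose_zero_right]
    have hP1 : ∀ i, polyHilb (i + 1) ((1 : ℕ) : ℤ) = i + 1 := fun i => by
      rw [polyHilb_succ_natCast, Nat.choose_one_right]
    rw [hc, hc] at h2
    simp only [hP0, hP1] at h2
    rw [Finset.sum_range_succ', Finset.sum_range_succ'] at h2
    have h3 : ∑ m ∈ Finset.range k, c (m + 1) * (m + 1 + 1) =
        ∑ m ∈ Finset.range k, c (m + 1) * m + 2 * ∑ m ∈ Finset.range k, c (m + 1) * 1 := by
      rw [Finset.mul_sum, ← Finset.sum_add_distrib]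
      exact Finset.sum_congr rfl fun m _ => by ring
    rw [h3] at h2
    push_cast at h2
    zify
    linarith


/-! ### Monomial ideals -/

section MonomialIdeal

variable {K : Type} [Field K] {n : ℕ} {I : Ideal (MvPolynomial (Fin n) K)}

theorem GenBy.mem_iff {P : (Fin n →₀ ℕ) → Prop} (h : GenBy I P) {f : MvPolynomial (Fin n) K} :
    f ∈ I ↔ ∀ b ∈ f.support, b ∈ expSet I := by
  obtain ⟨G, -, rfl⟩ := h
  have hexp : ∀ b, b ∈ expSet (Ideal.span ((fun a => monomial a (1 : K)) '' G)) ↔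
      ∃ a ∈ G, a ≤ b := fun b => by
    simp [expSet, mem_ideal_span_monomial_image]
  simp only [hexp, mem_ideal_span_monomial_image]

theorem GenBy.exists_le_of_mem_expSet {P : (Fin n →₀ ℕ) → Prop} (h : GenBy I P) {b : Fin n →₀ ℕ}
    (hb : b ∈ expSet I) : ∃ a ∈ expSet I, P a ∧ a ≤ b := by
  obtain ⟨G, hG, rfl⟩ := h
  have hb' := mem_ideal_span_monomial_image.1 hb b (by simp)
  obtain ⟨a, ha, hab⟩ := hb'
  exact ⟨a, Ideal.subset_span ⟨a, ha, rfl⟩, hG a ha, hab⟩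

theorem mem_expSet_of_le {a b : Fin n →₀ ℕ} (ha : a ∈ expSet I) (hab : a ≤ b) : b ∈ expSet I := by
  have : monomial b (1 : K) = monomial (b - a) 1 * monomial a 1 := by
    rw [monomial_mul, tsub_add_cancel_of_le hab, one_mul]
  rw [expSet, Set.mem_ofPred_eq, this]
  exact I.mul_mem_left _ ha

theorem GenBy.inf_homogeneousSubmodule_eq {P : (Fin n →₀ ℕ) → Prop} (h : GenBy I P) (e : ℕ) :
    I.restrictScalars K ⊓ homogeneousSubmodule (Fin n) K e =
      restrictSupport K {b | edeg b = e ∧ b ∈ expSet I} := by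
  ext f
  rw [Submodule.mem_inf, Submodule.restrictScalars_mem, h.mem_iff,
    homogeneousSubmodule_eq_finsupp_supported, mem_restrictSupport_iff]
  change (_ ∧ (f.support : Set (Fin n →₀ ℕ)) ⊆ _) ↔ _
  simp only [edeg_eq_degree]
  exact ⟨fun H b hb => ⟨H.2 hb, H.1 b hb⟩, fun H => ⟨fun b hb => (H hb).2, fun b hb => (H hb).1⟩⟩

theorem GenBy.hilb_eq_ncard {P : (Fin n →₀ ℕ) → Prop} (h : GenBy I P) (e : ℕ) :
    hilb I e = {b | edeg b = e ∧ b ∈ expSet I}.ncard := by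
  rw [hilb, h.inf_homogeneousSubmodule_eq e,
    Module.finrank_eq_nat_card_basis (basisRestrictSupport K _), Nat.card_coe_set_eq]

variable {d : ℕ}

theorem GenBy.setOf_edeg_eq (h : GenBy I fun a => edeg a = d) (e : ℕ) :
    {b | edeg b = e ∧ b ∈ expSet I} =
      multiplesOfDegree {a | edeg a = d ∧ a ∈ expSet I} e := by
  ext b
  constructor
  · rintro ⟨hb, hbI⟩
    obtain ⟨a, ha, had, hab⟩ := h.exists_le_of_mem_expSet hbI
    exact ⟨hb, a, ⟨had, ha⟩, hab⟩
  · rintro ⟨hb, a, ha, hab⟩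
    exact ⟨hb, mem_expSet_of_le ha.2 hab⟩

theorem GenBy.le_edeg (h : GenBy I fun a => edeg a = d) {b : Fin n →₀ ℕ} (hb : b ∈ expSet I) :
    d ≤ edeg b := by
  obtain ⟨a, -, had, hab⟩ := h.exists_le_of_mem_expSet hb
  exact had.ge.trans (edeg_mono hab)

theorem GenBy.hilb_eq_zero (h : GenBy I fun a => edeg a = d) {e : ℕ} (he : e < d) :
    hilb I e = 0 := by
  rw [h.hilb_eq_ncard, Set.ncard_eq_zero ((finite_setOf_edeg_eq n e).subset fun b hb => hb.1),
    Set.eq_empty_iff_forall_notMem]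
  rintro b ⟨hb, hbI⟩
  have := h.le_edeg hbI
  omega

theorem GenBy.homogeneousComponent_mul (h : GenBy I fun a => edeg a = d)
    (p : MvPolynomial (Fin n) K) {f : MvPolynomial (Fin n) K} (hf : f ∈ I) :
    homogeneousComponent d (p * f) = coeff 0 p • homogeneousComponent d f := by
  ext b
  rw [coeff_smul, coeff_homogeneousComponent, coeff_homogeneousComponent]
  split_ifs with hb
  · rw [coeff_mul, Finset.sum_eq_single (0, b), smul_eq_mul]
    · rintro ⟨u, v⟩ huv hne
      rw [Finset.HasAntidiagonal.mem_antidiagonal] at huv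
      dsimp only at huv ⊢
      by_cases hv : coeff v f = 0
      · rw [hv, mul_zero]
      · have hdv := h.le_edeg (h.mem_iff.1 hf v (mem_support_iff.2 hv))
        rw [← edeg_eq_degree, ← huv, edeg_add] at hb
        have hvb : v = b := eq_of_le_of_edeg_eq (huv ▸ le_add_self) (by
          rw [← huv, edeg_add]; omega)
        subst hvb
        exact absurd (by simpa using huv) (fun hu : u = 0 => hne (by rw [hu]))
    · simp
  · simp

theorem GenBy.hilb_le_card (h : GenBy I fun a => edeg a = d) (G : Finset (MvPolynomial (Fin n) K))
    (hG : I = Ideal.span (G : Set (MvPolynomial (Fin n) K))) : hilb I d ≤ G.card := by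
  classical
  have hle : I.restrictScalars K ⊓ homogeneousSubmodule (Fin n) K d ≤
      Submodule.span K (G.image (homogeneousComponent d) : Finset (MvPolynomial (Fin n) K)) := by
    rintro f ⟨hf, hfd⟩
    have hcomp : homogeneousComponent d f = f := by
      rw [homogeneousComponent_of_mem hfd, if_pos rfl]
    rw [← hcomp]
    have hf' : f ∈ Submodule.span (MvPolynomial (Fin n) K) (G : Set (MvPolynomial (Fin n) K)) := by
      have : f ∈ I := hf
      rw [hG] at this
      exact this
    clear hcomp hfd hf
    induction hf' using Submodule.span_induction with
    | mem x hx =>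
      exact Submodule.subset_span (by simpa using ⟨x, hx, rfl⟩)
    | zero => simp
    | add x y _ _ hx hy => rw [map_add]; exact add_mem hx hy
    | smul p x hx ih =>
      rw [smul_eq_mul, h.homogeneousComponent_mul p (by rw [hG]; exact hx)]
      exact Submodule.smul_mem _ _ ih
  exact (Submodule.finrank_mono hle).trans
    ((finrank_span_finset_le_card _).trans Finset.card_image_le)

theorem GenBy.mu_eq_hilb (h : GenBy I fun a => edeg a = d) : mu I = hilb I d := by
  classical
  have hfin : {b | edeg b = d ∧ b ∈ expSet I}.Finite :=
    (finite_setOf_edeg_eq n d).subset fun b hb => hb.1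
  have hmem : hilb I d ∈ {m | ∃ G : Finset (MvPolynomial (Fin n) K), G.card = m ∧
      I = Ideal.span (G : Set (MvPolynomial (Fin n) K))} := by
    refine ⟨hfin.toFinset.image fun a => monomial a (1 : K), ?_, le_antisymm ?_ ?_⟩
    · rw [Finset.card_image_of_injective _ (monomial_left_injective one_ne_zero),
        h.hilb_eq_ncard, Set.ncard_eq_toFinset_card _ hfin]
    · obtain ⟨G, hG, hIG⟩ := h
      conv_lhs => rw [hIG]
      refine Ideal.span_mono ?_
      rintro _ ⟨a, ha, rfl⟩
      have : a ∈ expSet I := by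
        rw [hIG]
        exact Ideal.subset_span ⟨a, ha, rfl⟩
      exact Finset.mem_coe.2 (Finset.mem_image_of_mem _ (hfin.mem_toFinset.2 ⟨hG a ha, this⟩))
    · rw [Ideal.span_le, Finset.coe_image, Set.Finite.coe_toFinset]
      rintro _ ⟨a, ha, rfl⟩
      exact ha.2
  refine le_antisymm (Nat.sInf_le hmem) (le_csInf ⟨_, hmem⟩ ?_)
  rintro _ ⟨G, rfl, hG⟩
  exact h.hilb_le_card G hG

theorem IsLexsegment.isLexSet (h : IsLexsegment I) (d : ℕ) :
    IsLexSet d {a | edeg a = d ∧ a ∈ expSet I} :=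
  ⟨fun _ ha => ha.1, fun a ha b hb hlex => ⟨hb, h.2 a b ha.2 (hb.trans ha.1.symm) hlex⟩⟩

theorem hdepth1_eq_one_iff (h1 : HilbertDecomp1 I 1) : hdepth1 I = 1 ↔ ¬HilbertDecomp1 I 2 := by
  rw [hdepth1]
  constructor
  · intro h h2
    have : ((2 : ℕ) : ℕ∞) ≤ 1 := h ▸ le_sSup ⟨2, h2, rfl⟩
    exact absurd this (by decide)
  · intro h2
    refine le_antisymm (sSup_le ?_) (le_sSup ⟨1, h1, by simp⟩)
    rintro _ ⟨m, hm, rfl⟩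
    by_contra! hlt
    have : 1 < m := by exact_mod_cast hlt
    exact h2 (IsPolySum.mono this hm)

end MonomialIdeal

/-- Theorem `hdepth_lex`(a). Let `I ⊂ S = K[x_1,…,x_n]` be a nonzero
lexsegment ideal generated by monomials of degree `d`. Then, in the standard graded case,
`hdepth_1(I) = 1` if and only if `μ(I) > ξ_{n-1}`. -/
theorem lexsegment_hdepth1_eq_one_iff {K : Type} [Field K] {n d : ℕ} (hn : 1 ≤ n)
    (I : Ideal (MvPolynomial (Fin n) K)) (hI : I ≠ ⊥) (hlex : IsLexsegment I)
    (hgen : GenBy I (fun a => edeg a = d)) :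
    hdepth1 I = 1 ↔ xi (n - 1) < mu I := by
  obtain ⟨k, rfl⟩ : ∃ k, n = k + 1 := ⟨n - 1, by omega⟩
  have hneg : ∀ j < (d : ℤ), hilbZ I j = 0 := fun j hj => by
    rw [hilbZ]
    split_ifs
    · exact hgen.hilb_eq_zero (by omega)
    · rfl
  have hf : ∀ t : ℕ, hilbZ I (d + t) =
      (multiplesOfDegree {a | edeg a = d ∧ a ∈ expSet I} (d + t)).ncard := fun t => by
    rw [hilbZ, if_pos (by omega), ← hgen.setOf_edeg_eq, ← hgen.hilb_eq_ncard]
    congr 1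
  obtain ⟨h1, h2⟩ := (hlex.isLexSet d).lexHilb.isPolySum_iff hneg hf
  rw [hdepth1_eq_one_iff h1, Nat.add_sub_cancel, ← not_le, hgen.mu_eq_hilb, hgen.hilb_eq_ncard,
    hgen.setOf_edeg_eq]
  exact not_congr h2
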